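/- arXiv:2301.13804 — 2 statements merged into one kernel-verified Lean document; each statement's English description precedes it below -/
import Mathlib

section
/- For every instance of the assignment problem with uncertain priorities (n agents, m ≥ n items, strict agent preferences, and a finitely supported random priority Σ), there exists a random assignment P that simultaneously satisfies ordinal efficiency (OE), stochastic envy-freeness (SEF), and 1-LEF. (This is the guarantee of the Cycle Elimination algorithm, Theorem on CE.) -/
open Finset

/-- `X` stochastically dominates `Y` under the ranking `π` (a bijection from items to ranks):
for every rank `t`, the cumulative probability of the `t` most-preferred items is at least
as large under `X` as under `Y`. -/
def SD {m : ℕ} (π : Equiv.Perm (Fin m)) (X Y : Fin m → ℝ) : Prop :=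
  ∀ t : Fin m, ∑ r ∈ Finset.Iic t, Y (π.symm r) ≤ ∑ r ∈ Finset.Iic t, X (π.symm r)

/-- A random assignment: an `n × m` matrix of nonnegative reals, each row summing to `1`
and each column summing to at most `1`. -/
def IsRandomAssignment {n m : ℕ} (P : Fin n → Fin m → ℝ) : Prop :=
  (∀ i j, 0 ≤ P i j) ∧ (∀ i, ∑ j, P i j = 1) ∧ (∀ j, ∑ i, P i j ≤ 1)

/-- A random priority: a (finitely supported) probability distribution over simple priorities
(bijections from agents to ranks). -/
def IsRandomPriority {n : ℕ} (ρ : Equiv.Perm (Fin n) → ℝ) : Prop :=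
  (∀ σ, 0 ≤ ρ σ) ∧ (∑ σ, ρ σ = 1)

/-- A lottery: a probability distribution over simple assignments (injective maps from
agents to items). -/
def IsLottery {n m : ℕ} (L : (Fin n → Fin m) → ℝ) : Prop :=
  (∀ f, 0 ≤ L f) ∧ (∑ f, L f = 1) ∧ (∀ f, L f ≠ 0 → Function.Injective f)

/-- The random assignment induced by a lottery: `p i j = Pr_{f ∼ L}[f i = j]`. -/
def induced {n m : ℕ} (L : (Fin n → Fin m) → ℝ) : Fin n → Fin m → ℝ :=
  fun i j => ∑ f ∈ Finset.univ.filter (fun f => f i = j), L f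

/-- `rankDist ρ i r = Pr_{σ ∼ Σ}[σ i = r]`, agent `i`'s rank distribution. -/
def rankDist {n : ℕ} (ρ : Equiv.Perm (Fin n) → ℝ) (i r : Fin n) : ℝ :=
  ∑ σ ∈ Finset.univ.filter (fun σ => σ i = r), ρ σ

/-- Ordinal efficiency: no other random assignment stochastically dominates `P`
for every agent. -/
def OE {n m : ℕ} (π : Fin n → Equiv.Perm (Fin m)) (P : Fin n → Fin m → ℝ) : Prop :=
  ¬ ∃ Q : Fin n → Fin m → ℝ, IsRandomAssignment Q ∧ Q ≠ P ∧ ∀ i, SD (π i) (Q i) (P i)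

/-- Stochastic envy-freeness: whenever `i`'s rank distribution (cumulatively)
stochastically dominates `j`'s, agent `i`'s allocation stochastically dominates `j`'s
under `i`'s preferences. -/
def SEF {n m : ℕ} (π : Fin n → Equiv.Perm (Fin m)) (ρ : Equiv.Perm (Fin n) → ℝ)
    (P : Fin n → Fin m → ℝ) : Prop :=
  ∀ i j : Fin n,
    (∀ t : Fin n, ∑ r ∈ Finset.Iic t, rankDist ρ j r ≤ ∑ r ∈ Finset.Iic t, rankDist ρ i r) →
    SD (π i) (P i) (P j)

/-- `Pr_{σ ∼ Σ}[σ i < σ j]`: the probability that agent `i` has higher priority than `j`. -/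
def prHigher {n : ℕ} (ρ : Equiv.Perm (Fin n) → ℝ) (i j : Fin n) : ℝ :=
  ∑ σ ∈ Finset.univ.filter (fun σ => σ i < σ j), ρ σ

/-- `Pr_{f ∼ L}[f i ≻_i f j]`: the probability that agent `i` prefers her own item to `j`'s. -/
def prPrefers {n m : ℕ} (π : Fin n → Equiv.Perm (Fin m)) (L : (Fin n → Fin m) → ℝ)
    (i j : Fin n) : ℝ :=
  ∑ f ∈ Finset.univ.filter (fun f => π i (f i) < π i (f j)), L f

/-- Likelihood envy-freeness: some lottery inducing `P` satisfies
`Pr[σ i < σ j] ≤ Pr[f i ≻_i f j]` for all agents `i`, `j`. -/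
def LEF {n m : ℕ} (π : Fin n → Equiv.Perm (Fin m)) (ρ : Equiv.Perm (Fin n) → ℝ)
    (P : Fin n → Fin m → ℝ) : Prop :=
  ∃ L : (Fin n → Fin m) → ℝ, IsLottery L ∧ induced L = P ∧
    ∀ i j : Fin n, prHigher ρ i j ≤ prPrefers π L i j

/-- 1-LEF: some lottery inducing `P` satisfies: whenever `i` has higher priority than `j`
with probability `1`, agent `i` prefers her item to `j`'s with probability `1`. -/
def OneLEF {n m : ℕ} (π : Fin n → Equiv.Perm (Fin m)) (ρ : Equiv.Perm (Fin n) → ℝ)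
    (P : Fin n → Fin m → ℝ) : Prop :=
  ∃ L : (Fin n → Fin m) → ℝ, IsLottery L ∧ induced L = P ∧
    ∀ i j : Fin n, i ≠ j → prHigher ρ i j = 1 → prPrefers π L i j = 1

/-- The baseline allocation of agent `i`: she gets her `r`-th preferred item with
probability `Pr[σ i = r]` (ranks beyond `n` get probability `0`). -/
def baseline {n m : ℕ} (π : Fin n → Equiv.Perm (Fin m)) (ρ : Equiv.Perm (Fin n) → ℝ)
    (i : Fin n) (j : Fin m) : ℝ :=
  ∑ σ ∈ Finset.univ.filter (fun σ => (σ i : ℕ) = (π i j : ℕ)), ρ σ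

/-- Ranked proportionality: every agent's allocation stochastically dominates
her baseline allocation. -/
def PROP {n m : ℕ} (π : Fin n → Equiv.Perm (Fin m)) (ρ : Equiv.Perm (Fin n) → ℝ)
    (P : Fin n → Fin m → ℝ) : Prop :=
  ∀ i : Fin n, SD (π i) (P i) (baseline π ρ i)

/-- Pareto efficiency of a simple assignment: no injective assignment makes every agent
weakly better off and some agent strictly better off. -/
def ParetoEff {n m : ℕ} (π : Fin n → Equiv.Perm (Fin m)) (f : Fin n → Fin m) : Prop :=
  ¬ ∃ g : Fin n → Fin m, Function.Injective g ∧
      (∀ i, g i = f i ∨ π i (g i) < π i (f i)) ∧ (∃ i, π i (g i) < π i (f i))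

/-- Envy-freeness of a simple assignment with respect to a simple priority. -/
def EnvyFree {n m : ℕ} (π : Fin n → Equiv.Perm (Fin m)) (σ : Equiv.Perm (Fin n))
    (f : Fin n → Fin m) : Prop :=
  ∀ i j : Fin n, σ i < σ j → π i (f i) < π i (f j)


/-- `X` reindexed by rank, extended by zero. -/
noncomputable def xs {m : ℕ} (p : Equiv.Perm (Fin m)) (X : Fin m → ℝ) (k : ℕ) : ℝ :=
  if h : k < m then X (p.symm ⟨k, h⟩) else 0

/-- running maximum of exhaustion times. -/
noncomputable def MM {m : ℕ} (p : Equiv.Perm (Fin m)) (T : Fin m → ℝ) : ℕ → ℝ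
  | 0 => 0
  | k + 1 => max (MM p T k) (xs p T k)

/-- amount eaten by time `t` by an agent that starts eating at time `c`. -/
noncomputable def EE (c t : ℝ) : ℝ := max 0 (min 1 (t - c))

/-- amount of item `b` eaten by agent `i` given exhaustion times `T`. -/
noncomputable def PP {n m : ℕ} (π : Fin n → Equiv.Perm (Fin m)) (κ : Fin n → ℝ)
    (T : Fin m → ℝ) (i : Fin n) (b : Fin m) : ℝ :=
  max 0 (EE (κ i) (T b) - EE (κ i) (MM (π i) T (π i b)))

lemma xs_apply {m : ℕ} (p : Equiv.Perm (Fin m)) (X : Fin m → ℝ) (b : Fin m) :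
    xs p X (p b) = X b := by
  simp [xs]

lemma xs_lt {m : ℕ} (p : Equiv.Perm (Fin m)) {k : ℕ} (h : k < m) :
    ∃ b, (p b : ℕ) = k ∧ ∀ X : Fin m → ℝ, xs p X k = X b := by
  refine ⟨p.symm ⟨k, h⟩, by simp, fun X => by simp [xs, h]⟩

lemma sum_xs {m : ℕ} (p : Equiv.Perm (Fin m)) (X : Fin m → ℝ) :
    ∑ l ∈ range m, xs p X l = ∑ b, X b := by
  rw [← Equiv.sum_comp p.symm X, ← Fin.sum_univ_eq_sum_range]
  simp [xs]

lemma sum_Iic {m : ℕ} (f : Fin m → ℝ) (g : ℕ → ℝ) (hfg : ∀ r : Fin m, f r = g r) (t : Fin m) :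
    ∑ r ∈ Finset.Iic t, f r = ∑ l ∈ range (t + 1), g l := by
  have : range (t + 1) = (Finset.Iic t).map Fin.valEmbedding := by
    ext a
    simp only [Finset.mem_range, Finset.mem_map, Finset.mem_Iic, Fin.valEmbedding_apply]
    constructor
    · intro h
      exact ⟨⟨a, by omega⟩, by rw [Fin.le_def]; simp; omega, rfl⟩
    · rintro ⟨b, hb, rfl⟩
      rw [Fin.le_def] at hb; omega
  rw [this, Finset.sum_map]
  exact Finset.sum_congr rfl fun r _ => hfg r

lemma SD_iff {m : ℕ} (p : Equiv.Perm (Fin m)) (X Y : Fin m → ℝ) :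
    SD p X Y ↔ ∀ k < m, ∑ l ∈ range (k + 1), xs p Y l ≤ ∑ l ∈ range (k + 1), xs p X l := by
  unfold SD
  have h : ∀ (X : Fin m → ℝ) (t : Fin m), ∑ r ∈ Finset.Iic t, X (p.symm r)
      = ∑ l ∈ range (t + 1), xs p X l := fun X t =>
    sum_Iic (fun r => X (p.symm r)) (xs p X) (fun r => by simp [xs]) t
  simp only [h]
  exact ⟨fun H k hk => H ⟨k, hk⟩, fun H t => H t t.2⟩

lemma abel_sum (u x : ℕ → ℝ) (k : ℕ) :
    ∑ l ∈ range k, u l * x l = u k * ∑ l ∈ range k, x l +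
      ∑ l ∈ range k, (u l - u (l + 1)) * ∑ j ∈ range (l + 1), x j := by
  induction k with
  | zero => simp
  | succ k ih => rw [sum_range_succ, ih, sum_range_succ (fun l => (u l - u (l + 1)) * _) k, sum_range_succ x k]; ring

lemma EE_mono (c : ℝ) {s t : ℝ} (h : s ≤ t) : EE c s ≤ EE c t := by
  unfold EE; gcongr

lemma EE_nonneg (c t : ℝ) : 0 ≤ EE c t := le_max_left _ _
lemma EE_le_one (c t : ℝ) : EE c t ≤ 1 := by unfold EE; simp

lemma EE_anti {c d : ℝ} (h : c ≤ d) (t : ℝ) : EE d t ≤ EE c t := by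
  unfold EE; gcongr

lemma EE_one {c t : ℝ} (h : c + 1 ≤ t) : EE c t = 1 := by
  unfold EE; rw [min_eq_left (by linarith)]; simp

lemma EE_zero {c t : ℝ} (h : t ≤ c) : EE c t = 0 := by
  unfold EE; rw [max_eq_left]; exact (min_le_right _ _).trans (by linarith)

lemma EE_max (c s t : ℝ) : EE c (max s t) = EE c s + max 0 (EE c t - EE c s) := by
  rcases le_total s t with h | h
  · rw [max_eq_right h, max_eq_right (by linarith [EE_mono c h])]; ring
  · rw [max_eq_left h, max_eq_left (by linarith [EE_mono c h])]; ring

lemma MM_mono {m : ℕ} (p : Equiv.Perm (Fin m)) (T : Fin m → ℝ) : Monotone (MM p T) :=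
  monotone_nat_of_le_succ fun _ => le_max_left _ _

lemma MM_nonneg {m : ℕ} (p : Equiv.Perm (Fin m)) (T : Fin m → ℝ) (k : ℕ) : 0 ≤ MM p T k :=
  MM_mono p T (Nat.zero_le k)

lemma MM_succ {m : ℕ} (p : Equiv.Perm (Fin m)) (T : Fin m → ℝ) (b : Fin m) :
    MM p T (p b + 1) = max (MM p T (p b)) (T b) := by
  simp [MM, xs_apply]

lemma le_MM {m : ℕ} (p : Equiv.Perm (Fin m)) (T : Fin m → ℝ) (b : Fin m) (k : ℕ)
    (h : (p b : ℕ) < k) : T b ≤ MM p T k :=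
  le_trans (by rw [MM_succ]; exact le_max_right _ _) (MM_mono p T h)

lemma xs_mono {m : ℕ} (p : Equiv.Perm (Fin m)) {T T' : Fin m → ℝ} (h : T ≤ T') (k : ℕ) :
    xs p T k ≤ xs p T' k := by
  unfold xs; split_ifs
  · exact h _
  · exact le_rfl

lemma MM_mono_T {m : ℕ} (p : Equiv.Perm (Fin m)) {T T' : Fin m → ℝ} (h : T ≤ T') (k : ℕ) :
    MM p T k ≤ MM p T' k := by
  induction k with
  | zero => exact le_rfl
  | succ k ih => exact max_le_max ih (xs_mono p h k)

lemma MM_le {m : ℕ} (p : Equiv.Perm (Fin m)) {T : Fin m → ℝ} {K : ℝ} (hK : 0 ≤ K)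
    (h : ∀ b, T b ≤ K) (k : ℕ) : MM p T k ≤ K := by
  induction k with
  | zero => exact hK
  | succ k ih =>
    refine max_le ih ?_
    unfold xs; split_ifs
    · exact h _
    · exact hK

lemma MM_cont {m : ℕ} (p : Equiv.Perm (Fin m)) (k : ℕ) :
    Continuous (fun T : Fin m → ℝ => MM p T k) := by
  induction k with
  | zero => exact continuous_const
  | succ k ih =>
    refine ih.max ?_
    unfold xs; split_ifs
    · exact continuous_apply _
    · exact continuous_const

lemma EE_cont (c : ℝ) : Continuous (EE c) := by unfold EE; fun_prop

lemma PP_cont {n m : ℕ} (π : Fin n → Equiv.Perm (Fin m)) (κ : Fin n → ℝ) (i : Fin n) (b : Fin m) :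
    Continuous (fun T => PP π κ T i b) := by
  unfold PP
  exact continuous_const.max (((EE_cont _).comp (continuous_apply b)).sub
    ((EE_cont _).comp (MM_cont _ _)))

lemma PP_nonneg {n m : ℕ} (π : Fin n → Equiv.Perm (Fin m)) (κ : Fin n → ℝ) (T : Fin m → ℝ)
    (i : Fin n) (b : Fin m) : 0 ≤ PP π κ T i b := le_max_left _ _

lemma cum_PP {n m : ℕ} (π : Fin n → Equiv.Perm (Fin m)) (κ : Fin n → ℝ) (hκ : ∀ i, 0 ≤ κ i)
    (T : Fin m → ℝ) (i : Fin n) (k : ℕ) (hk : k ≤ m) :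
    ∑ l ∈ range k, xs (π i) (PP π κ T i) l = EE (κ i) (MM (π i) T k) := by
  induction k with
  | zero => simp [MM, EE_zero (hκ i)]
  | succ k ih =>
    obtain ⟨b, rfl, hb⟩ := xs_lt (π i) hk
    rw [sum_range_succ, ih (by omega), MM_succ, EE_max, hb]
    rfl

lemma sum_set_PP {n m : ℕ} (π : Fin n → Equiv.Perm (Fin m)) (κ : Fin n → ℝ) (hκ : ∀ i, 0 ≤ κ i)
    (T : Fin m → ℝ) (i : Fin n) (A : Finset (Fin m)) (τ : ℝ) (hA : ∀ b ∈ A, T b ≤ τ) :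
    ∑ b ∈ A, PP π κ T i b ≤ EE (κ i) τ := by
  have key : ∀ k ≤ m, ∑ l ∈ range k, xs (π i) (fun b => if b ∈ A then PP π κ T i b else 0) l
      ≤ min (EE (κ i) (MM (π i) T k)) (EE (κ i) τ) := by
    intro k hk
    induction k with
    | zero => simp [EE_nonneg]
    | succ k ih =>
      obtain ⟨b, rfl, hb⟩ := xs_lt (π i) hk
      have ih := ih (by omega)
      rw [sum_range_succ, MM_succ, EE_max, hb]
      have h0 := PP_nonneg π κ T i b
      have h1 := EE_mono (κ i) (MM_mono (π i) T (Nat.le_succ (π i b)))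
      have hP : PP π κ T i b = max 0 (EE (κ i) (T b) - EE (κ i) (MM (π i) T (π i b))) := rfl
      rw [le_min_iff] at ih ⊢
      rw [← hP]
      split_ifs with hbA
      · have h2 := EE_mono (κ i) (hA b hbA)
        refine ⟨by linarith [ih.1], ?_⟩
        rcases max_cases 0 (EE (κ i) (T b) - EE (κ i) (MM (π i) T (π i b))) with h | h <;>
          rw [h.1] at hP <;> linarith [ih.1, ih.2]
      · constructor <;> linarith [ih.1, ih.2]
  have := key m le_rfl
  rw [sum_xs] at this
  simp only [Finset.sum_ite_mem, Finset.univ_inter] at this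
  exact this.trans (min_le_right _ _)

lemma exists_T {n m : ℕ} (π : Fin n → Equiv.Perm (Fin m)) (κ : Fin n → ℝ) (hκ : ∀ i, 0 ≤ κ i)
    (K : ℝ) (hK : 0 ≤ K) : ∃ T : Fin m → ℝ, (∀ b, 0 ≤ T b) ∧ (∀ b, T b ≤ K) ∧
      (∀ b, ∑ i, PP π κ T i b ≤ 1) ∧ ∀ b, T b < K → ∑ i, PP π κ T i b = 1 := by
  let F : Set (Fin m → ℝ) := Set.Icc 0 (fun _ => K) ∩ {T | ∀ b, ∑ i, PP π κ T i b ≤ 1}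
  have hc : ∀ b, Continuous (fun T => ∑ i, PP π κ T i b) := fun b =>
    continuous_finsetSum _ fun i _ => PP_cont π κ i b
  have hF : IsCompact F := by
    refine isCompact_Icc.inter_right ?_
    rw [Set.ofPred_forall]
    exact isClosed_iInter fun b => isClosed_le (hc b) continuous_const
  have hne : F.Nonempty := by
    refine ⟨0, ⟨le_rfl, fun _ => hK⟩, fun b => ?_⟩
    refine le_trans (Finset.sum_nonpos fun i _ => ?_) zero_le_one
    unfold PP
    rw [Pi.zero_apply, EE_zero (hκ i)]
    simp [EE_nonneg]
  obtain ⟨T, hT, hmax⟩ := hF.exists_isMaxOn hne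
    (f := fun T => ∑ b, T b) (by fun_prop)
  refine ⟨T, hT.1.1, hT.1.2, hT.2, fun b hb => ?_⟩
  by_contra hlt
  have hlt : ∑ i, PP π κ T i b < 1 := lt_of_le_of_ne (hT.2 b) hlt
  have hcu : Continuous (fun s : ℝ => Function.update T b s) := by fun_prop
  have h1 : ∀ᶠ s in nhdsWithin (T b) (Set.Ioi (T b)), ∑ i, PP π κ (Function.update T b s) i b < 1 := by
    apply Filter.Eventually.filter_mono nhdsWithin_le_nhds
    refine ((hc b).comp hcu).continuousAt.eventually_lt continuousAt_const ?_
    simpa using hlt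
  have h2 : ∀ᶠ s in nhdsWithin (T b) (Set.Ioi (T b)), s < K :=
    Filter.Eventually.filter_mono nhdsWithin_le_nhds (Iio_mem_nhds hb)
  obtain ⟨s, hs1, hs2, hs3⟩ := (h1.and (h2.and self_mem_nhdsWithin)).exists
  have hs3 : T b < s := hs3
  have hle : T ≤ Function.update T b s := by
    rw [le_update_iff]; exact ⟨hs3.le, fun _ _ => le_rfl⟩
  have hmem : Function.update T b s ∈ F := by
    refine ⟨⟨le_trans hT.1.1 hle, ?_⟩, fun c => ?_⟩
    · rw [update_le_iff]; exact ⟨hs2.le, fun c _ => hT.1.2 c⟩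
    · by_cases hcb : c = b
      · subst hcb; exact hs1.le
      · refine le_trans (Finset.sum_le_sum fun i _ => ?_) (hT.2 c)
        unfold PP
        rw [Function.update_of_ne hcb]
        have := EE_mono (κ i) (MM_mono_T (π i) hle (π i c))
        exact max_le_max le_rfl (by linarith)
  have := hmax hmem
  simp only [Set.mem_ofPred_eq] at this
  have h4 : ∑ c, T c < ∑ c, Function.update T b s c :=
    Finset.sum_lt_sum (fun c _ => hle c) ⟨b, Finset.mem_univ _, by simpa using hs3⟩
  linarith

lemma row_sum {n m : ℕ} (hm : n ≤ m) (π : Fin n → Equiv.Perm (Fin m)) (κ : Fin n → ℝ)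
    (hκ : ∀ i, 0 ≤ κ i) (K : ℝ) (hκK : ∀ i, κ i + 1 ≤ K) (T : Fin m → ℝ)
    (h1 : ∀ b, T b ≤ K) (h2 : ∀ b, T b < K → ∑ i, PP π κ T i b = 1) (i : Fin n) :
    ∑ b, PP π κ T i b = 1 := by
  have hr : ∀ i, ∑ b, PP π κ T i b = EE (κ i) (MM (π i) T m) := fun i => by
    rw [← sum_xs (π i), cum_PP π κ hκ T i m le_rfl]
  by_cases h : ∃ b, T b = K
  · obtain ⟨b, hb⟩ := h
    rw [hr]
    apply EE_one
    exact le_trans (hκK i) (hb ▸ le_MM (π i) T b m (π i b).2)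
  · push Not at h
    have hcol : ∑ i, ∑ b, PP π κ T i b = m := by
      rw [Finset.sum_comm]
      rw [Finset.sum_congr rfl fun b _ => h2 b (lt_of_le_of_ne (h1 b) (h b))]
      simp
    have hle : ∀ i ∈ (Finset.univ : Finset (Fin n)), ∑ b, PP π κ T i b ≤ 1 := fun i _ => by
      rw [hr]; exact EE_le_one _ _
    have hsum : ∑ i, ∑ b, PP π κ T i b = ∑ i : Fin n, (1 : ℝ) := by
      refine le_antisymm (Finset.sum_le_sum hle) ?_
      rw [hcol]; simpa using hm
    exact (Finset.sum_eq_sum_iff_of_le hle).1 hsum i (Finset.mem_univ _)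

lemma SEF_aux {n m : ℕ} (π : Fin n → Equiv.Perm (Fin m)) (κ : Fin n → ℝ) (hκ : ∀ i, 0 ≤ κ i)
    (T : Fin m → ℝ) (i j : Fin n) (hij : κ i ≤ κ j) :
    SD (π i) (PP π κ T i) (PP π κ T j) := by
  rw [SD_iff]
  intro k hk
  rw [cum_PP π κ hκ T i (k + 1) hk]
  refine le_trans ?_ (EE_anti hij _)
  have h := sum_set_PP π κ hκ T j (Finset.univ.filter fun b => (π i b : ℕ) < k + 1)
    (MM (π i) T (k + 1)) (fun b hb => le_MM _ _ _ _ (by simpa using hb))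
  refine le_trans (le_of_eq ?_) h
  rw [Finset.sum_filter, ← sum_xs (π i)]
  rw [← Finset.sum_subset (Finset.range_mono (show k + 1 ≤ m from hk))]
  · refine Finset.sum_congr rfl fun l hl => ?_
    rw [Finset.mem_range] at hl
    obtain ⟨b, rfl, hb⟩ := xs_lt (π i) (show l < m by omega)
    rw [hb, hb, if_pos hl]
  · intro l hl hl'
    rw [Finset.mem_range] at hl hl'
    obtain ⟨b, rfl, hb⟩ := xs_lt (π i) hl
    rw [hb, if_neg hl']

lemma EF_aux {n m : ℕ} (π : Fin n → Equiv.Perm (Fin m)) (κ : Fin n → ℝ)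
    (T : Fin m → ℝ) (i j : Fin n) (hij : κ i + 1 ≤ κ j) (a b : Fin m)
    (hb : 0 < PP π κ T i b) (ha : 0 < PP π κ T j a) : π i b ≤ π i a := by
  by_contra hlt
  push Not at hlt
  have h1 : 0 < EE (κ j) (T a) := by
    by_contra h
    have := EE_nonneg (κ j) (MM (π j) T (π j a))
    unfold PP at ha
    rw [max_eq_left (by linarith)] at ha
    exact lt_irrefl _ ha
  have h2 : κ j < T a := by
    by_contra h
    rw [EE_zero (by linarith)] at h1
    exact lt_irrefl _ h1
  have h3 := le_MM (π i) T a (π i b) hlt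
  have h4 := EE_one (c := κ i) (t := MM (π i) T (π i b)) (by linarith)
  unfold PP at hb
  rw [h4, max_eq_left (by linarith [EE_le_one (κ i) (T b)])] at hb
  exact lt_irrefl _ hb

lemma wsum_xs {m : ℕ} (p : Equiv.Perm (Fin m)) (X : Fin m → ℝ) (u : ℕ → ℝ) :
    ∑ b, u (p b) * X b = ∑ l ∈ range m, u l * xs p X l := by
  rw [← sum_xs p]
  refine Finset.sum_congr rfl fun l hl => ?_
  obtain ⟨b, rfl, hb⟩ := xs_lt p (Finset.mem_range.1 hl)
  rw [hb, hb]

lemma OE_aux {n m : ℕ} (π : Fin n → Equiv.Perm (Fin m)) (κ : Fin n → ℝ) (hκ : ∀ i, 0 ≤ κ i)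
    (K : ℝ) (hK : 0 ≤ K) (T : Fin m → ℝ) (h1 : ∀ b, T b ≤ K)
    (h2 : ∀ b, T b < K → ∑ i, PP π κ T i b = 1) (hrow : ∀ i, ∑ b, PP π κ T i b = 1) :
    OE π (PP π κ T) := by
  rintro ⟨Q, hQ, hne, hsd⟩
  let u : Fin n → ℕ → ℝ := fun i k => K - MM (π i) T (k + 1)
  have hu : ∀ i k, 0 ≤ u i k - u i (k + 1) := fun i k => by
    have := MM_mono (π i) T (Nat.le_succ (k + 1))
    simp only [u, Nat.succ_eq_add_one] at this ⊢; linarith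
  have hdiff : ∀ i, ∑ b, u i (π i b) * Q i b - ∑ b, u i (π i b) * PP π κ T i b =
      ∑ l ∈ range m, (u i l - u i (l + 1)) * (∑ j ∈ range (l + 1), xs (π i) (Q i) j
        - ∑ j ∈ range (l + 1), xs (π i) (PP π κ T i) j) := fun i => by
    rw [wsum_xs, wsum_xs, abel_sum, abel_sum (u i) (xs (π i) (PP π κ T i)), sum_xs, sum_xs,
      hrow, hQ.2.1]
    simp only [mul_sub, Finset.sum_sub_distrib]
    ring
  have hsd' := fun i => (SD_iff _ _ _).1 (hsd i)
  have hterm : ∀ i, ∀ l ∈ range m, 0 ≤ (u i l - u i (l + 1)) *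
      (∑ j ∈ range (l + 1), xs (π i) (Q i) j - ∑ j ∈ range (l + 1), xs (π i) (PP π κ T i) j) :=
    fun i l hl => mul_nonneg (hu i l) (sub_nonneg.2 (hsd' i l (Finset.mem_range.1 hl)))
  have hle : ∀ i ∈ (Finset.univ : Finset (Fin n)),
      ∑ b, u i (π i b) * PP π κ T i b ≤ ∑ b, u i (π i b) * Q i b := fun i _ => by
    have := Finset.sum_nonneg (hterm i)
    rw [← hdiff] at this; linarith
  have hPu : ∀ i b, u i (π i b) * PP π κ T i b = (K - T b) * PP π κ T i b := fun i b => by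
    simp only [u, MM_succ]
    rcases le_total (MM (π i) T (π i b)) (T b) with h | h
    · rw [max_eq_right h]
    · have : PP π κ T i b = 0 := max_eq_left (by linarith [EE_mono (κ i) h])
      rw [this]; simp
  have hge : ∑ i, ∑ b, u i (π i b) * Q i b ≤ ∑ i, ∑ b, u i (π i b) * PP π κ T i b := by
    calc ∑ i, ∑ b, u i (π i b) * Q i b ≤ ∑ i, ∑ b, (K - T b) * Q i b := by
          refine Finset.sum_le_sum fun i _ => Finset.sum_le_sum fun b _ => ?_
          refine mul_le_mul_of_nonneg_right ?_ (hQ.1 i b)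
          simp only [u, MM_succ]
          linarith [le_max_right (MM (π i) T (π i b)) (T b)]
      _ = ∑ b, (K - T b) * ∑ i, Q i b := by
          rw [Finset.sum_comm]; simp only [Finset.mul_sum]
      _ ≤ ∑ b, (K - T b) * ∑ i, PP π κ T i b := by
          refine Finset.sum_le_sum fun b _ => ?_
          rcases (h1 b).lt_or_eq with h | h
          · rw [h2 b h]
            exact mul_le_mul_of_nonneg_left (hQ.2.2 b) (by linarith)
          · rw [h]; simp
      _ = ∑ i, ∑ b, u i (π i b) * PP π κ T i b := by
          simp only [hPu, Finset.mul_sum]; rw [Finset.sum_comm]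
  have heq := (Finset.sum_eq_sum_iff_of_le hle).1 (le_antisymm (Finset.sum_le_sum hle) hge)
  apply hne
  have hcum : ∀ i, ∀ d ≤ m, ∑ j ∈ range (m - d), xs (π i) (Q i) j
      = ∑ j ∈ range (m - d), xs (π i) (PP π κ T i) j := by
    intro i d
    induction d with
    | zero => intro _; simp only [Nat.sub_zero]; rw [sum_xs, sum_xs, hrow, hQ.2.1]
    | succ d ih =>
      intro hd
      have ih := ih (by omega)
      obtain ⟨k, hk⟩ : ∃ k, m - (d + 1) = k := ⟨_, rfl⟩
      have hk' : m - d = k + 1 := by omega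
      rw [hk]; rw [hk'] at ih
      rcases Nat.eq_zero_or_pos k with rfl | hkpos
      · simp
      obtain ⟨l, rfl⟩ : ∃ l, k = l + 1 := ⟨k - 1, by omega⟩
      have hs := hsd' i l (by omega)
      by_contra hn
      have hlt := lt_of_le_of_ne hs (Ne.symm hn)
      have h0 : ∑ l ∈ range m, (u i l - u i (l + 1)) * (∑ j ∈ range (l + 1), xs (π i) (Q i) j
        - ∑ j ∈ range (l + 1), xs (π i) (PP π κ T i) j) = 0 := by
        rw [← hdiff, heq i (Finset.mem_univ _), sub_self]
      have h3 := (Finset.sum_eq_zero_iff_of_nonneg (hterm i)).1 h0 l (by simp; omega)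
      rcases mul_eq_zero.1 h3 with h4 | h4
      · have h5 : MM (π i) T (l + 1) = MM (π i) T (l + 1 + 1) := by
          simp only [u] at h4; linarith
        have h6 := cum_PP π κ hκ T i (l + 1) (by omega)
        have h7 := cum_PP π κ hκ T i (l + 1 + 1) (by omega)
        rw [← h5, ← h6, ← ih, sum_range_succ _ (l + 1)] at h7
        obtain ⟨b, hb1, hb2⟩ := xs_lt (π i) (show l + 1 < m by omega)
        rw [hb2] at h7
        linarith [hQ.1 i b]
      · linarith
  funext i b
  have hc1 := hcum i (m - π i b) (by omega)
  have hc2 := hcum i (m - (π i b + 1)) (by omega)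
  have e1 : m - (m - (π i b : ℕ)) = π i b := by have := (π i b).2; omega
  have e2 : m - (m - ((π i b : ℕ) + 1)) = π i b + 1 := by have := (π i b).2; omega
  rw [e1] at hc1
  rw [e2, sum_range_succ, sum_range_succ, hc1, xs_apply, xs_apply] at hc2
  linarith

lemma exists_lottery {n m : ℕ} (hm : n ≤ m) (P : Fin n → Fin m → ℝ) (hP : IsRandomAssignment P) :
    ∃ L : (Fin n → Fin m) → ℝ, IsLottery L ∧ induced L = P := by
  obtain ⟨h0, hr, hc⟩ := hP
  have htot : ∑ b, ∑ i, P i b = n := by rw [Finset.sum_comm]; simp [hr]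
  let A : Matrix (Fin m) (Fin m) ℝ := fun i b =>
    if h : (i : ℕ) < n then P ⟨i, h⟩ b else (1 - ∑ i, P i b) / (m - n : ℝ)
  have hA : A ∈ doublyStochastic ℝ (Fin m) := by
    rw [mem_doublyStochastic_iff_sum]
    refine ⟨fun i b => ?_, fun i => ?_, fun b => ?_⟩
    · simp only [A]; split_ifs
      · exact h0 _ _
      · exact div_nonneg (by linarith [hc b]) (by simpa using hm)
    · simp only [A]; split_ifs with h
      · exact hr _
      · rw [← Finset.sum_div, Finset.sum_sub_distrib, htot]
        have : (n : ℝ) < m := by exact_mod_cast (lt_of_le_of_lt (not_lt.1 h) i.2)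
        simp only [sum_const, card_univ, Fintype.card_fin, nsmul_eq_mul, mul_one]
        exact div_self (by linarith)
    · obtain ⟨k, rfl⟩ := Nat.exists_eq_add_of_le hm
      rw [Fin.sum_univ_add]
      simp only [A, Fin.val_castAdd, Fin.is_lt, dite_true, Fin.val_natAdd, Fin.eta]
      have hn : ∀ j : Fin k, ¬ (n + (j : ℕ) < n) := fun j => by omega
      simp only [hn, dite_false, sum_const, card_univ, Fintype.card_fin, nsmul_eq_mul]
      rcases Nat.eq_zero_or_pos k with rfl | hk
      · have := (Finset.sum_eq_sum_iff_of_le (s := Finset.univ) (fun b _ => hc b)).1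
          (by rw [htot]; simp) b (Finset.mem_univ _)
        simp [this]
      · have : (k : ℝ) ≠ 0 := by positivity
        push_cast
        rw [add_sub_cancel_left, mul_div_cancel₀ _ this]
        ring
  obtain ⟨w, hw0, hw1, hw⟩ := exists_eq_sum_perm_of_mem_doublyStochastic hA
  let r : Equiv.Perm (Fin m) → Fin n → Fin m := fun τ i => τ (Fin.castLE hm i)
  refine ⟨fun f => ∑ τ ∈ Finset.univ.filter (fun τ => r τ = f), w τ, ⟨?_, ?_, ?_⟩, ?_⟩
  · exact fun f => Finset.sum_nonneg fun τ _ => hw0 τ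
  · rw [← hw1]
    exact Finset.sum_fiberwise _ _ _
  · intro f hf
    obtain ⟨τ, hτ, -⟩ := Finset.exists_ne_zero_of_sum_ne_zero hf
    rw [← (Finset.mem_filter.1 hτ).2]
    exact τ.injective.comp (Fin.castLE_injective hm)
  · funext i b
    have e := congrFun (congrFun hw (Fin.castLE hm i)) b
    simp only [Matrix.sum_apply, Matrix.smul_apply, A, Fin.val_castLE, Fin.is_lt, dite_true,
      Fin.eta, Equiv.Perm.permMatrix, PEquiv.toMatrix_apply, Equiv.toPEquiv_apply,
      Option.mem_some_iff, smul_eq_mul, mul_ite, mul_one, mul_zero] at e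
    rw [← e]
    simp only [induced, Finset.sum_filter]
    have : ∀ f : Fin n → Fin m, (if f i = b then ∑ τ, if r τ = f then w τ else 0 else 0)
        = ∑ τ, if r τ = f then (if r τ i = b then w τ else 0) else 0 := by
      intro f
      split_ifs with h
      · refine Finset.sum_congr rfl fun τ _ => ?_
        split_ifs with h1 h2 h2
        · rfl
        · exact absurd (h1 ▸ h) h2
        · rfl
      · symm
        refine Finset.sum_eq_zero fun τ _ => ?_
        split_ifs with h1 h2
        · exact absurd (h1 ▸ h2) h
        · rfl
        · rfl
    simp only [this]
    rw [Finset.sum_comm]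
    simp [r]

/-- expected rank -/
noncomputable def expRank {n : ℕ} (ρ : Equiv.Perm (Fin n) → ℝ) (i : Fin n) : ℝ :=
  ∑ σ, ρ σ * ((σ i : ℕ) : ℝ)

lemma expRank_eq {n : ℕ} (ρ : Equiv.Perm (Fin n) → ℝ) (i : Fin n) :
    expRank ρ i = ∑ l ∈ range n, (l : ℝ) * xs 1 (rankDist ρ i) l := by
  rw [← wsum_xs 1 (rankDist ρ i) (fun l => (l : ℝ))]
  simp only [rankDist, expRank, Finset.mul_sum, Finset.sum_filter]
  rw [Finset.sum_comm]
  refine Finset.sum_congr rfl fun σ _ => ?_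
  simp [mul_comm]

lemma sum_rankDist {n : ℕ} (ρ : Equiv.Perm (Fin n) → ℝ) (i : Fin n) :
    ∑ r, rankDist ρ i r = ∑ σ, ρ σ := by
  unfold rankDist
  exact Finset.sum_fiberwise _ _ _

lemma expRank_le {n : ℕ} (ρ : Equiv.Perm (Fin n) → ℝ) (i j : Fin n)
    (h : ∀ t : Fin n, ∑ r ∈ Finset.Iic t, rankDist ρ j r ≤ ∑ r ∈ Finset.Iic t, rankDist ρ i r) :
    expRank ρ i ≤ expRank ρ j := by
  have h' : SD 1 (rankDist ρ i) (rankDist ρ j) := h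
  rw [SD_iff] at h'
  rw [expRank_eq, expRank_eq, abel_sum, abel_sum _ (xs 1 (rankDist ρ j)), sum_xs, sum_xs,
    sum_rankDist, sum_rankDist]
  refine add_le_add le_rfl (Finset.sum_le_sum fun l hl => ?_)
  have := h' l (Finset.mem_range.1 hl)
  push_cast
  linarith

lemma expRank_lt {n : ℕ} (ρ : Equiv.Perm (Fin n) → ℝ) (hρ : IsRandomPriority ρ) (i j : Fin n)
    (h : prHigher ρ i j = 1) : expRank ρ i + 1 ≤ expRank ρ j := by
  unfold prHigher at h
  have hz : ∀ σ, ¬ (σ i < σ j) → ρ σ = 0 := by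
    have h2 := Finset.sum_filter_add_sum_filter_not Finset.univ (fun σ => σ i < σ j) ρ
    rw [h, hρ.2] at h2
    have h3 := (Finset.sum_eq_zero_iff_of_nonneg (fun σ _ => hρ.1 σ)).1
      (show ∑ σ ∈ Finset.univ.filter (fun σ : Equiv.Perm (Fin n) => ¬ (σ i < σ j)), ρ σ = 0 by
        linarith)
    exact fun σ hσ => h3 σ (by simpa using hσ)
  rw [← hρ.2, expRank, expRank, ← Finset.sum_add_distrib]
  refine Finset.sum_le_sum fun σ _ => ?_
  by_cases hσ : σ i < σ j
  · have : ((σ i : ℕ) : ℝ) + 1 ≤ ((σ j : ℕ) : ℝ) := by exact_mod_cast hσ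
    nlinarith [hρ.1 σ]
  · rw [hz σ hσ]; simp

/-- **Theorem (Cycle Elimination).** For every instance of the assignment problem with
uncertain priorities, there exists a random assignment satisfying OE, SEF and 1-LEF. -/
theorem exists_OE_SEF_OneLEF (n m : ℕ) (hm : n ≤ m)
    (π : Fin n → Equiv.Perm (Fin m)) (ρ : Equiv.Perm (Fin n) → ℝ)
    (hρ : IsRandomPriority ρ) :
    ∃ P : Fin n → Fin m → ℝ,
      IsRandomAssignment P ∧ OE π P ∧ SEF π ρ P ∧ OneLEF π ρ P := by
  have hκ : ∀ i, 0 ≤ expRank ρ i := fun i =>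
    Finset.sum_nonneg fun σ _ => mul_nonneg (hρ.1 σ) (Nat.cast_nonneg _)
  have hκK : ∀ i, expRank ρ i + 1 ≤ (n : ℝ) := fun i => by
    have h1 : (n : ℝ) = ∑ σ, ρ σ * n := by rw [← Finset.sum_mul, hρ.2, one_mul]
    rw [h1]
    nth_rw 1 [← hρ.2]
    rw [expRank, ← Finset.sum_add_distrib]
    refine Finset.sum_le_sum fun σ _ => ?_
    have : ((σ i : ℕ) : ℝ) + 1 ≤ n := by exact_mod_cast (σ i).2
    nlinarith [hρ.1 σ]
  obtain ⟨T, -, hTK, hcol, hcol1⟩ := exists_T π (expRank ρ) hκ (n : ℝ) (Nat.cast_nonneg n)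
  have hrow := row_sum hm π (expRank ρ) hκ n hκK T hTK hcol1
  have hRA : IsRandomAssignment (PP π (expRank ρ) T) :=
    ⟨PP_nonneg π _ T, hrow, hcol⟩
  refine ⟨PP π (expRank ρ) T, hRA,
    OE_aux π _ hκ n (Nat.cast_nonneg n) T hTK hcol1 hrow,
    fun i j h => SEF_aux π _ hκ T i j (expRank_le ρ i j h), ?_⟩
  obtain ⟨L, hL, hLP⟩ := exists_lottery hm _ hRA
  refine ⟨L, hL, hLP, fun i j hij h => ?_⟩
  have hpos : ∀ f, L f ≠ 0 → ∀ i, 0 < PP π (expRank ρ) T i (f i) := fun f hf i => by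
    rw [← hLP]
    refine lt_of_lt_of_le (lt_of_le_of_ne (hL.1 f) hf.symm) ?_
    exact Finset.single_le_sum (f := L) (fun g _ => hL.1 g) (by simp)
  unfold prPrefers
  rw [← hL.2.1, Finset.sum_filter]
  refine Finset.sum_congr rfl fun f _ => ?_
  split_ifs with hf
  · rfl
  · by_contra hne
    have hne := Ne.symm hne
    have hle := EF_aux π _ T i j (expRank_lt ρ hρ i j h) (f j) (f i) (hpos f hne i) (hpos f hne j)
    refine hf (lt_of_le_of_ne hle fun he => hij (hL.2.2 f hne ((π i).injective he)))
end

section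
/- No random assignment can guarantee ordinal efficiency, ranked proportionality, and 1-LEF simultaneously: there exists an instance of the assignment problem with uncertain priorities (agents, items, strict agent preferences, and a finitely supported random priority Σ) such that no random assignment satisfies OE, PROP, and 1-LEF at the same time. -/
open Finset

/-- Agents `0, 1` rank item `1` first and item `0` second; agents `2, 3` rank item `0` first. -/
def cexPref (i : Fin 4) : Equiv.Perm (Fin 4) :=
  if i = 0 ∨ i = 1 then Equiv.swap 0 1 else 1

/-- The priority order `2, 3, 0, 1`. -/
def cexTau : Equiv.Perm (Fin 4) := Equiv.addRight 2

/-- The orders `0, 1, 2, 3` and `2, 3, 0, 1`, each with probability one half. -/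
noncomputable def cexPrio (σ : Equiv.Perm (Fin 4)) : ℝ :=
  (if σ = 1 then 1 / 2 else 0) + (if σ = cexTau then 1 / 2 else 0)

theorem cexPrio_sum (p : Equiv.Perm (Fin 4) → Prop) [DecidablePred p] :
    ∑ σ ∈ Finset.univ.filter p, cexPrio σ =
      (if p 1 then 1 / 2 else 0) + (if p cexTau then 1 / 2 else 0) := by
  unfold cexPrio
  rw [Finset.sum_add_distrib, Finset.sum_ite_eq', Finset.sum_ite_eq']
  simp

/-- If `i` surely does not envy `j`, then `j` never receives the top item of `i`. -/
theorem induced_top_eq_zero {n m : ℕ} (π : Fin n → Equiv.Perm (Fin m))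
    (L : (Fin n → Fin m) → ℝ) (hL : IsLottery L) (i j : Fin n)
    (h : prPrefers π L i j = 1) (x : Fin m) (hx : (π i x : ℕ) = 0) :
    induced L j x = 0 := by
  have h1 := Finset.sum_filter_add_sum_filter_not Finset.univ
    (fun f : Fin n → Fin m => π i (f i) < π i (f j)) L
  unfold prPrefers at h
  rw [h, hL.2.1] at h1
  have h2 : ∑ f ∈ Finset.univ.filter (fun f : Fin n → Fin m => ¬ π i (f i) < π i (f j)), L f
      = 0 := by linarith
  apply le_antisymm
  · rw [← h2]
    apply Finset.sum_le_sum_of_subset_of_nonneg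
    · intro f hf
      simp only [Finset.mem_filter, Finset.mem_univ, true_and] at hf ⊢
      rw [hf, Fin.lt_def, hx]
      exact Nat.not_lt_zero _
    · intro f _ _
      exact hL.1 f
  · exact Finset.sum_nonneg fun f _ => hL.1 f

/-- Agents `1` and `3` trade half a unit of items `0` and `1`. -/
noncomputable def cexTrade (P : Fin 4 → Fin 4 → ℝ) (i j : Fin 4) : ℝ :=
  P i j + (if i = 1 ∧ j = 1 ∨ i = 3 ∧ j = 0 then 1 / 2 else 0)
    - (if i = 1 ∧ j = 0 ∨ i = 3 ∧ j = 1 then 1 / 2 else 0)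

theorem Iic4_0 : Finset.Iic (0 : Fin 4) = {0} := by decide
theorem Iic4_1 : Finset.Iic (1 : Fin 4) = {0, 1} := by decide
theorem Iic4_2 : Finset.Iic (2 : Fin 4) = {0, 1, 2} := by decide
theorem Iic4_3 : Finset.Iic (3 : Fin 4) = {0, 1, 2, 3} := by decide

/-- **Theorem.** OE, PROP and 1-LEF are incompatible: there is an instance such that no
random assignment satisfies all three. -/
theorem OE_PROP_OneLEF_incompatible :
    ∃ (n m : ℕ), n ≤ m ∧
      ∃ (π : Fin n → Equiv.Perm (Fin m)) (ρ : Equiv.Perm (Fin n) → ℝ),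
        IsRandomPriority ρ ∧
        ∀ P : Fin n → Fin m → ℝ, IsRandomAssignment P →
          ¬ (OE π P ∧ PROP π ρ P ∧ OneLEF π ρ P) := by
  refine ⟨4, 4, le_rfl, cexPref, cexPrio, ⟨?_, ?_⟩, ?_⟩
  · intro σ
    unfold cexPrio
    positivity
  · have := cexPrio_sum (fun _ => True)
    simp only [Finset.filter_true, if_true] at this
    rw [this]; norm_num
  rintro P hP ⟨hOE, hPROP, L, hL, hLP, hLEF⟩
  have t0 : cexTau 0 = 2 := by decide
  have t1 : cexTau 1 = 3 := by decide
  have t2 : cexTau 2 = 0 := by decide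
  have t3 : cexTau 3 = 1 := by decide
  have p1 : cexPref 1 = Equiv.swap 0 1 := by decide
  have p3 : cexPref 3 = 1 := by decide
  have s0 : (Equiv.swap (0 : Fin 4) 1) 0 = 1 := by decide
  have s1 : (Equiv.swap (0 : Fin 4) 1) 1 = 0 := by decide
  have s2 : (Equiv.swap (0 : Fin 4) 1) 2 = 2 := by decide
  have s3 : (Equiv.swap (0 : Fin 4) 1) 3 = 3 := by decide
  have z1 : P 1 1 = 0 := by
    rw [← hLP]
    refine induced_top_eq_zero cexPref L hL 0 1 (hLEF 0 1 (by decide) ?_) 1 (by decide)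
    unfold prHigher
    rw [cexPrio_sum, t0, t1]
    norm_num [Fin.lt_def]
  have z3 : P 3 0 = 0 := by
    rw [← hLP]
    refine induced_top_eq_zero cexPref L hL 2 3 (hLEF 2 3 (by decide) ?_) 0 (by decide)
    unfold prHigher
    rw [cexPrio_sum, t2, t3]
    norm_num [Fin.lt_def]
  have g1 : 1 / 2 ≤ P 1 0 := by
    have h := hPROP 1 1
    rw [Iic4_1, Finset.sum_pair (by decide), Finset.sum_pair (by decide)] at h
    unfold baseline at h
    rw [cexPrio_sum, cexPrio_sum, p1, Equiv.symm_swap, s0, s1, t1, s0, z1] at h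
    norm_num at h
    linarith
  have g3 : 1 / 2 ≤ P 3 1 := by
    have h := hPROP 3 1
    rw [Iic4_1, Finset.sum_pair (by decide), Finset.sum_pair (by decide)] at h
    unfold baseline at h
    rw [cexPrio_sum, cexPrio_sum, p3, t3] at h
    have e0 : (Equiv.symm (1 : Equiv.Perm (Fin 4))) 0 = 0 := rfl
    have e1 : (Equiv.symm (1 : Equiv.Perm (Fin 4))) 1 = 1 := rfl
    rw [e0, e1, z3] at h
    norm_num at h
    linarith
  apply hOE
  refine ⟨cexTrade P, ⟨?_, ?_, ?_⟩, ?_, ?_⟩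
  · intro i j
    have h := hP.1 i j
    unfold cexTrade
    by_cases hc : i = 1 ∧ j = 0 ∨ i = 3 ∧ j = 1
    · rw [if_pos hc]
      rcases hc with ⟨rfl, rfl⟩ | ⟨rfl, rfl⟩
      · simp; linarith
      · simp; linarith
    · rw [if_neg hc]
      have h2 : (0 : ℝ) ≤ if i = 1 ∧ j = 1 ∨ i = 3 ∧ j = 0 then 1 / 2 else 0 := by
        split_ifs <;> norm_num
      linarith
  · intro i
    have h := hP.2.1 i
    rw [Fin.sum_univ_four] at h ⊢
    unfold cexTrade
    fin_cases i <;> simp at h ⊢ <;> linarith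
  · intro j
    have h := hP.2.2 j
    rw [Fin.sum_univ_four] at h ⊢
    unfold cexTrade
    fin_cases j <;> simp at h ⊢ <;> linarith
  · intro h
    have h' := congrFun (congrFun h 1) 1
    unfold cexTrade at h'
    simp at h'
  · intro i t
    have hi : i = 0 ∨ i = 1 ∨ i = 2 ∨ i = 3 := by revert i; decide
    have ht : t = 0 ∨ t = 1 ∨ t = 2 ∨ t = 3 := by revert t; decide
    rcases hi with rfl | rfl | rfl | rfl
    · simp [cexTrade]
    · rw [p1, Equiv.symm_swap]
      rcases ht with rfl | rfl | rfl | rfl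
      · simp [Iic4_0, cexTrade]
      · simp [Iic4_1, cexTrade]; linarith
      · simp [Iic4_2, cexTrade, s2]; linarith
      · simp [Iic4_3, cexTrade, s2, s3]; linarith
    · simp [cexTrade]
    · rw [p3]
      have e (r : Fin 4) : (Equiv.symm (1 : Equiv.Perm (Fin 4))) r = r := rfl
      simp only [e]
      rcases ht with rfl | rfl | rfl | rfl
      · simp [Iic4_0, cexTrade]
      · simp [Iic4_1, cexTrade]; linarith
      · simp [Iic4_2, cexTrade]; linarith
      · simp [Iic4_3, cexTrade]; linarith
end
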